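/- Let M be a symmetric irreducible r×r 0–1 transition matrix and let A : Σ̂_M → ℝ be Lipschitz continuous. For β > 0, let φ⁺_β be the forward effective potential for βA (normalized by φ⁺_β(y⁰) = 0 at a fixed y⁰) and λ⁺_β the effective constant. Assume φ⁺_{β_n}/β_n → V uniformly for some sequence β_n → ∞. Then there exists a family {U_y}_{y ∈ Σ*_M} of sub-actions with respect to A(y,·) + V − V(y) such that the map (y,x) ↦ A(y,x) + U_y(x) − U_y(σ(x)) is Borel measurable and bounded on Σ̂_M, and lim_{β→∞} λ⁺_β/β = sup_{η̂ : π_*(η̂) = π*_*(η̂)} ∬_{Σ̂_M} [ A(y,x) + U_y(x) − U_y(σ(x)) ] dη̂(y,x), where the supremum is over Borel probability measures η̂ on Σ̂_M whose two marginals coincide under the identification Σ*_M ≅ Σ_M. -/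

import Mathlib

open MeasureTheory Filter Topology Real

/-- The one-sided subshift of finite type defined by the 0-1 transition matrix `M`:
sequences `x : ℕ → Fin r` with `M (x j) (x (j+1)) = 1` for all `j`. -/
abbrev Shift (r : ℕ) (M : Fin r → Fin r → Bool) : Type :=
  {x : ℕ → Fin r // ∀ j : ℕ, M (x j) (x (j + 1)) = true}

variable {r : ℕ} {M : Fin r → Fin r → Bool}

/-- The matrix `M` is irreducible: any symbol can be joined to any other by an
admissible path of positive length. -/
def Irred (M : Fin r → Fin r → Bool) : Prop :=
  ∀ i j : Fin r, ∃ n : ℕ, ∃ w : Fin (n + 2) → Fin r,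
    w 0 = i ∧ w (Fin.last (n + 1)) = j ∧
    ∀ k : Fin (n + 1), M (w k.castSucc) (w k.succ) = true

/-- The left shift map on the subshift. -/
def shiftMap (x : Shift r M) : Shift r M :=
  ⟨fun j => x.1 (j + 1), fun j => x.2 (j + 1)⟩

/-- The metric `d(x,y) = Λ^k`, `k = min { j : x_j ≠ y_j }`, `d(x,x) = 0`. -/
noncomputable def shiftDist (Λ : ℝ) (x y : Shift r M) : ℝ :=
  letI := Classical.decEq (Shift r M)
  if h : x = y then 0
  else Λ ^ Nat.find (show ∃ j : ℕ, x.1 j ≠ y.1 j by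
    by_contra hc
    push_neg at hc
    exact h (Subtype.ext (funext hc)))

/-- `φ` is Lipschitz with constant `K` for the metric `shiftDist Λ`. -/
def LipBnd (Λ K : ℝ) (φ : Shift r M → ℝ) : Prop :=
  ∀ x y : Shift r M, |φ x - φ y| ≤ K * shiftDist Λ x y

/-- `φ` is Lipschitz continuous for the metric `shiftDist Λ`. -/
def IsLip (Λ : ℝ) (φ : Shift r M → ℝ) : Prop :=
  ∃ K : ℝ, LipBnd Λ K φ

/-- The best Lipschitz constant of `φ`. -/
noncomputable def lipC (Λ : ℝ) (φ : Shift r M → ℝ) : ℝ :=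
  sInf {K : ℝ | 0 ≤ K ∧ LipBnd Λ K φ}

/-- The uniform norm `‖φ‖₀`. -/
noncomputable def unorm (φ : Shift r M → ℝ) : ℝ :=
  ⨆ x : Shift r M, |φ x|

/-- An observable on the natural extension `Σ̂_M ⊂ Σ*_M × Σ_M` (with `Σ*_M`
canonically identified with `Σ_M`), as a function of `(y, x)`; it is Lipschitz with
constant `K` for the max-metric. -/
def LipBnd2 (Λ K : ℝ) (A : Shift r M → Shift r M → ℝ) : Prop :=
  ∀ y x y' x' : Shift r M,
    |A y x - A y' x'| ≤ K * max (shiftDist Λ y y') (shiftDist Λ x x')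

/-- `A` is Lipschitz continuous on `Σ̂_M`. -/
def IsLip2 (Λ : ℝ) (A : Shift r M → Shift r M → ℝ) : Prop :=
  ∃ K : ℝ, LipBnd2 Λ K A

/-- The best Lipschitz constant of the observable `A`. -/
noncomputable def lipC2 (Λ : ℝ) (A : Shift r M → Shift r M → ℝ) : ℝ :=
  sInf {K : ℝ | 0 ≤ K ∧ LipBnd2 Λ K A}

/-- The uniform norm `‖A‖₀` of the observable. -/
noncomputable def unorm2 (A : Shift r M → Shift r M → ℝ) : ℝ :=
  ⨆ p : Shift r M × Shift r M, |A p.1 p.2|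

/-- `μ` is a `σ`-invariant Borel probability measure on the subshift. -/
def InvProb (μ : Measure (Shift r M)) : Prop :=
  IsProbabilityMeasure μ ∧ μ.map shiftMap = μ

/-- Entropy of the cylinder partition of length `n`:
`H_n(μ) = - ∑_{|w| = n} μ([w]) log μ([w])`. -/
noncomputable def cylEnt (μ : Measure (Shift r M)) (n : ℕ) : ℝ :=
  ∑ w : Fin n → Fin r,
    Real.negMulLog ((μ {x : Shift r M | ∀ i : Fin n, x.1 i.1 = w i}).toReal)

/-- The Kolmogorov–Sinai entropy `h_μ(σ)` of an invariant measure on the subshift: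
since the cylinder partition is generating and `n ↦ H_n(μ)` is subadditive,
`h_μ(σ) = lim_n H_n(μ)/n = inf_n H_n(μ)/n`. -/
noncomputable def entropy (μ : Measure (Shift r M)) : ℝ :=
  ⨅ n : ℕ, cylEnt μ (n + 1) / (n + 1)

/-- The operator
`G⁺_A(φ)(y) = sup_{μ ∈ M_σ} [ ∫ (A(y,x) + φ(x)) dμ(x) + h_μ(σ) ]`. -/
noncomputable def Gplus (A : Shift r M → Shift r M → ℝ)
    (φ : Shift r M → ℝ) (y : Shift r M) : ℝ :=
  sSup {t : ℝ | ∃ μ : Measure (Shift r M), InvProb μ ∧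
    t = ∫ x, (A y x + φ x) ∂μ + entropy μ}

/-- The maximal ergodic average `max_{μ ∈ M_σ} ∫ B dμ`. -/
noncomputable def maxErg (B : Shift r M → ℝ) : ℝ :=
  sSup {t : ℝ | ∃ μ : Measure (Shift r M), InvProb μ ∧ t = ∫ x, B x ∂μ}

/-- The quotient norm on functions modulo additive constants:
`‖g‖_c = inf_{γ ∈ ℝ} ‖g + γ‖₀`. -/
noncomputable def cnorm (g : Shift r M → ℝ) : ℝ :=
  ⨅ γ : ℝ, unorm (fun x => g x + γ)

/-! ### The metric -/

lemma sd_self (Λ : ℝ) (x : Shift r M) : shiftDist Λ x x = 0 := by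
  simp [shiftDist]

lemma sd_nonneg {Λ : ℝ} (hΛ : Λ ∈ Set.Ioo (0 : ℝ) 1) (x y : Shift r M) :
    0 ≤ shiftDist Λ x y := by
  unfold shiftDist
  split_ifs
  · exact le_rfl
  · exact pow_nonneg hΛ.1.le _

lemma sd_le_pow_iff {Λ : ℝ} (hΛ : Λ ∈ Set.Ioo (0 : ℝ) 1) (x y : Shift r M) (k : ℕ) :
    shiftDist Λ x y ≤ Λ ^ k ↔ ∀ j < k, x.1 j = y.1 j := by
  unfold shiftDist
  split_ifs with h
  · subst h
    simp [pow_nonneg hΛ.1.le k]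
  · rw [pow_le_pow_iff_right_of_lt_one₀ hΛ.1 hΛ.2, Nat.le_find_iff]
    simp

lemma sd_le_one {Λ : ℝ} (hΛ : Λ ∈ Set.Ioo (0 : ℝ) 1) (x y : Shift r M) :
    shiftDist Λ x y ≤ 1 := by
  have := (sd_le_pow_iff hΛ x y 0).2 (by simp)
  simpa using this

lemma sd_comm {Λ : ℝ} (x y : Shift r M) :
    shiftDist Λ x y = shiftDist Λ y x := by
  unfold shiftDist
  by_cases h : x = y
  · simp [h]
  · have h' : ¬ y = x := fun e => h e.symm
    rw [dif_neg h, dif_neg h']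
    congr 2
    funext j
    exact propext ne_comm

lemma sd_head_ne {Λ : ℝ} (x y : Shift r M) (h0 : x.1 0 ≠ y.1 0) :
    shiftDist Λ x y = 1 := by
  have h : ¬ x = y := fun e => h0 (by rw [e])
  unfold shiftDist
  rw [dif_neg h]
  have : Nat.find (show ∃ j : ℕ, x.1 j ≠ y.1 j from ⟨0, h0⟩) = 0 := by
    rw [Nat.find_eq_zero]; exact h0
  rw [this, pow_zero]

lemma sd_eq_pow_or {Λ : ℝ} (x y : Shift r M) :
    x = y ∨ ∃ k : ℕ, shiftDist Λ x y = Λ ^ k := by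
  by_cases h : x = y
  · exact Or.inl h
  · right
    unfold shiftDist
    rw [dif_neg h]
    exact ⟨_, rfl⟩

lemma sd_ultra {Λ : ℝ} (hΛ : Λ ∈ Set.Ioo (0 : ℝ) 1) (x y z : Shift r M) :
    shiftDist Λ x z ≤ max (shiftDist Λ x y) (shiftDist Λ y z) := by
  rcases sd_eq_pow_or (Λ := Λ) x y with h | ⟨k, hk⟩
  · subst h; exact le_max_right _ _
  rcases sd_eq_pow_or (Λ := Λ) y z with h | ⟨l, hl⟩
  · subst h; exact le_max_left _ _
  have h1 := (sd_le_pow_iff hΛ x y k).1 hk.le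
  have h2 := (sd_le_pow_iff hΛ y z l).1 hl.le
  have : shiftDist Λ x z ≤ Λ ^ (min k l) := (sd_le_pow_iff hΛ x z _).2 fun j hj =>
    (h1 j (lt_of_lt_of_le hj (min_le_left _ _))).trans
      (h2 j (lt_of_lt_of_le hj (min_le_right _ _)))
  rw [hk, hl]
  rcases le_total k l with hkl | hkl
  · rw [min_eq_left hkl] at this; exact le_max_of_le_left this
  · rw [min_eq_right hkl] at this; exact le_max_of_le_right this

lemma sd_shift {Λ : ℝ} (hΛ : Λ ∈ Set.Ioo (0 : ℝ) 1) (x y : Shift r M) (h0 : x.1 0 = y.1 0) :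
    shiftDist Λ x y = Λ * shiftDist Λ (shiftMap x) (shiftMap y) := by
  apply le_antisymm
  · rcases sd_eq_pow_or (Λ := Λ) (shiftMap x) (shiftMap y) with h | ⟨k, hk⟩
    · have : x = y := by
        apply Subtype.ext
        funext j
        cases j with
        | zero => exact h0
        | succ j => exact congrFun (congrArg Subtype.val h) j
      subst this
      simp [sd_self]
    · rw [hk, ← pow_succ', sd_le_pow_iff hΛ]
      have h := (sd_le_pow_iff hΛ _ _ k).1 hk.le
      intro j hj
      cases j with
      | zero => exact h0
      | succ j => exact h j (by omega)
  · rcases sd_eq_pow_or (Λ := Λ) x y with h | ⟨k, hk⟩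
    · subst h; simp [sd_self]
    · have h := (sd_le_pow_iff hΛ _ _ k).1 hk.le
      rw [hk]
      cases k with
      | zero =>
        simp only [pow_zero]
        have := sd_le_one hΛ (shiftMap x) (shiftMap y)
        nlinarith [hΛ.1, hΛ.2, sd_nonneg hΛ (shiftMap x) (shiftMap y)]
      | succ k =>
        rw [pow_succ']
        refine mul_le_mul_of_nonneg_left ?_ hΛ.1.le
        rw [sd_le_pow_iff hΛ]
        intro j hj
        exact h (j + 1) (by omega)

lemma iter_apply (n : ℕ) (x : Shift r M) (j : ℕ) :
    (shiftMap^[n] x).1 j = x.1 (j + n) := by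
  induction n generalizing x with
  | zero => rfl
  | succ n ih =>
    rw [Function.iterate_succ_apply, ih]
    rfl

lemma sd_iter {Λ : ℝ} (hΛ : Λ ∈ Set.Ioo (0 : ℝ) 1) (n : ℕ) (x y : Shift r M)
    (h : ∀ j < n, x.1 j = y.1 j) :
    shiftDist Λ x y = Λ ^ n * shiftDist Λ (shiftMap^[n] x) (shiftMap^[n] y) := by
  induction n generalizing x y with
  | zero => simp
  | succ n ih =>
    rw [sd_shift hΛ x y (h 0 (by omega)),
      ih (shiftMap x) (shiftMap y) (fun j hj => h (j + 1) (by omega))]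
    rw [Function.iterate_succ_apply, Function.iterate_succ_apply, pow_succ']
    ring

/-! ### Continuity -/

lemma agree_nhds (x : Shift r M) (k : ℕ) : ∀ᶠ y in 𝓝 x, ∀ j < k, x.1 j = y.1 j := by
  have h : ∀ j : ℕ, ∀ᶠ y : Shift r M in 𝓝 x, x.1 j = y.1 j := by
    intro j
    have hc : Continuous (fun y : Shift r M => y.1 j) :=
      (continuous_apply j).comp continuous_subtype_val
    have : ({x.1 j} : Set (Fin r)) ∈ 𝓝 (x.1 j) := by simp
    filter_upwards [hc.continuousAt.preimage_mem_nhds this] with y hy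
    exact (Set.mem_singleton_iff.1 hy).symm
  have : ∀ᶠ y in 𝓝 x, ∀ j ∈ Finset.range k, x.1 j = y.1 j :=
    (Filter.eventually_all_finset _).2 fun j _ => h j
  filter_upwards [this] with y hy j hj
  exact hy j (Finset.mem_range.2 hj)

lemma sd_small {Λ : ℝ} (hΛ : Λ ∈ Set.Ioo (0 : ℝ) 1) (x : Shift r M) {ε : ℝ} (hε : 0 < ε) :
    ∀ᶠ y in 𝓝 x, shiftDist Λ x y < ε := by
  obtain ⟨k, hk⟩ := exists_pow_lt_of_lt_one hε hΛ.2
  filter_upwards [agree_nhds x k] with y hy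
  exact ((sd_le_pow_iff hΛ x y k).2 hy).trans_lt hk

lemma lip_mono {Λ : ℝ} (hΛ : Λ ∈ Set.Ioo (0 : ℝ) 1) {K K' : ℝ} (h : K ≤ K')
    {f : Shift r M → ℝ} (hf : LipBnd Λ K f) : LipBnd Λ K' f := fun x y =>
  (hf x y).trans (mul_le_mul_of_nonneg_right h (sd_nonneg hΛ x y))

lemma lip_cont {Λ : ℝ} (hΛ : Λ ∈ Set.Ioo (0 : ℝ) 1) {K : ℝ}
    {f : Shift r M → ℝ} (hf : LipBnd Λ K f) : Continuous f := by
  have hf' := lip_mono hΛ (show K ≤ |K| + 1 by linarith [le_abs_self K]) hf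
  rw [continuous_iff_continuousAt]
  intro x
  rw [ContinuousAt, Metric.tendsto_nhds]
  intro ε hε
  have hK : 0 < |K| + 1 := by positivity
  filter_upwards [sd_small hΛ x (div_pos hε hK)] with y hy
  rw [dist_comm, Real.dist_eq]
  refine (hf' x y).trans_lt ?_
  rw [lt_div_iff₀ hK] at hy
  linarith

lemma sd_lip {Λ : ℝ} (hΛ : Λ ∈ Set.Ioo (0 : ℝ) 1) (z : Shift r M) :
    LipBnd Λ 1 (fun x => shiftDist Λ x z) := by
  have key : ∀ x y : Shift r M, shiftDist Λ x z - shiftDist Λ y z ≤ shiftDist Λ x y := by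
    intro x y
    have := sd_ultra hΛ x y z
    have h1 := sd_nonneg hΛ x y
    have h2 := sd_nonneg hΛ y z
    rcases max_cases (shiftDist Λ x y) (shiftDist Λ y z) with h | h <;> linarith [h.1]
  intro x y
  rw [one_mul, abs_le]
  have h1 := key x y
  have h2 := key y x
  rw [sd_comm y x] at h2
  constructor <;> linarith

lemma lip2_cont {Λ : ℝ} (hΛ : Λ ∈ Set.Ioo (0 : ℝ) 1) {K : ℝ}
    {A : Shift r M → Shift r M → ℝ} (hA : LipBnd2 Λ K A) :
    Continuous (fun p : Shift r M × Shift r M => A p.1 p.2) := by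
  rw [continuous_iff_continuousAt]
  rintro ⟨y, x⟩
  rw [ContinuousAt, Metric.tendsto_nhds]
  intro ε hε
  have hK : 0 < |K| + 1 := by positivity
  have e1 := (continuous_fst.tendsto (y, x)).eventually (sd_small hΛ y (div_pos hε hK))
  have e2 := (continuous_snd.tendsto (y, x)).eventually (sd_small hΛ x (div_pos hε hK))
  filter_upwards [e1, e2] with p h1 h2
  rw [dist_comm, Real.dist_eq]
  have hm := max_lt h1 h2
  have hm0 : 0 ≤ max (shiftDist Λ y p.1) (shiftDist Λ x p.2) :=
    le_max_of_le_left (sd_nonneg hΛ _ _)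
  have := hA y x p.1 p.2
  rw [lt_div_iff₀ hK] at hm
  have h3 := le_abs_self K
  show |A y x - A p.1 p.2| < ε
  nlinarith

lemma shiftMap_cont : Continuous (shiftMap : Shift r M → Shift r M) := by
  refine Continuous.subtype_mk (continuous_pi fun j => ?_) _
  exact (continuous_apply (j + 1)).comp continuous_subtype_val

instance shiftSecondCountable : SecondCountableTopology (Shift r M) :=
  TopologicalSpace.Subtype.secondCountableTopology _

instance shiftMetrizable : TopologicalSpace.MetrizableSpace (Shift r M) :=
  (Topology.IsEmbedding.subtypeVal (p := fun x : ℕ → Fin r =>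
    ∀ j : ℕ, M (x j) (x (j + 1)) = true)).metrizableSpace

instance shiftCompact : CompactSpace (Shift r M) := by
  suffices hcl : IsClosed {x : ℕ → Fin r | ∀ j : ℕ, M (x j) (x (j + 1)) = true} from
    isCompact_iff_compactSpace.1 hcl.isCompact
  have : {x : ℕ → Fin r | ∀ j : ℕ, M (x j) (x (j + 1)) = true}
      = ⋂ j : ℕ, {x : ℕ → Fin r | M (x j) (x (j + 1)) = true} := by
    ext x; simp
  rw [this]
  refine isClosed_iInter fun j => ?_
  have hc : Continuous (fun x : ℕ → Fin r => M (x j) (x (j + 1))) := by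
    have h1 : Continuous (fun q : Fin r × Fin r => M q.1 q.2) := continuous_of_discreteTopology
    have h2 : Continuous (fun x : ℕ → Fin r => (x j, x (j + 1))) :=
      (continuous_apply j).prodMk (continuous_apply (j + 1))
    exact h1.comp h2
  exact isClosed_eq hc continuous_const

lemma cont_bdd {f : Shift r M → ℝ} (hf : Continuous f) : ∃ C, 0 ≤ C ∧ ∀ x, |f x| ≤ C := by
  obtain ⟨C, hC⟩ := isCompact_univ.exists_bound_of_continuousOn (f := f) hf.continuousOn
  exact ⟨max C 0, le_max_right _ _, fun x => (hC x trivial).trans (le_max_left _ _)⟩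

lemma cont_int {f : Shift r M → ℝ} (hf : Continuous f) (μ : Measure (Shift r M))
    [IsProbabilityMeasure μ] : Integrable f μ := by
  obtain ⟨C, _, hC⟩ := cont_bdd hf
  exact Integrable.of_bound hf.measurable.aestronglyMeasurable C (Filter.Eventually.of_forall hC)

/-! ### Invariant measures -/

/-- The orbit measure of a periodic point. -/
noncomputable def orbMeas (n : ℕ) (p : Shift r M) : Measure (Shift r M) :=
  ((n : ENNReal)⁻¹) • ∑ k ∈ Finset.range n, Measure.dirac (shiftMap^[k] p)

lemma orb_inv (n : ℕ) (hn : 0 < n) (p : Shift r M) (hp : shiftMap^[n] p = p) :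
    InvProb (orbMeas n p) := by
  constructor
  · constructor
    unfold orbMeas
    simp only [Measure.smul_apply, Measure.finsetSum_apply, measure_univ, Finset.sum_const,
      Finset.card_range, smul_eq_mul, nsmul_eq_mul, mul_one]
    exact ENNReal.inv_mul_cancel (by exact_mod_cast hn.ne') (by simp)
  · unfold orbMeas
    rw [Measure.map_smul, Measure.map_finset_sum shiftMap_cont.measurable.aemeasurable]
    congr 1
    have h1 : ∀ k, (Measure.dirac (shiftMap^[k] p)).map shiftMap
        = Measure.dirac (shiftMap^[k + 1] p) := by
      intro k
      rw [Measure.map_dirac' shiftMap_cont.measurable, Function.iterate_succ_apply']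
    simp only [h1]
    have h2 := Finset.sum_range_succ (fun k => Measure.dirac (shiftMap^[k] p)) n
    have h3 := Finset.sum_range_succ' (fun k => Measure.dirac (shiftMap^[k] p)) n
    simp only [hp, Function.iterate_zero, id] at h2 h3
    rw [h2] at h3
    obtain ⟨m, rfl⟩ : ∃ m, n = m + 1 := ⟨n - 1, by omega⟩
    rw [Finset.sum_range_succ, hp, Finset.sum_range_succ' (fun k => Measure.dirac (shiftMap^[k] p))]
    rfl

lemma orb_integral (n : ℕ) (p : Shift r M) {f : Shift r M → ℝ} :
    ∫ x, f x ∂(orbMeas n p) = (n : ℝ)⁻¹ * birkhoffSum shiftMap f n p := by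
  unfold orbMeas birkhoffSum
  rw [integral_smul_measure, integral_finsetSum_measure]
  · simp
  · intro i _
    exact integrable_dirac (by simp)

lemma max_exists (hne : ∃ μ : Measure (Shift r M), InvProb μ)
    {B : Shift r M → ℝ} (hB : Continuous B) :
    ∃ ν : Measure (Shift r M), InvProb ν ∧ ∀ μ, InvProb μ → ∫ x, B x ∂μ ≤ ∫ x, B x ∂ν := by
  let S : Set (ProbabilityMeasure (Shift r M)) :=
    {μ | μ.map shiftMap_cont.measurable.aemeasurable = μ}
  have hcl : IsClosed S :=
    isClosed_eq (ProbabilityMeasure.continuous_map shiftMap_cont) continuous_id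
  obtain ⟨μ0, h0, h0'⟩ := hne
  have hS : S.Nonempty := ⟨⟨μ0, h0⟩, Subtype.ext h0'⟩
  have hc : Continuous (fun μ : ProbabilityMeasure (Shift r M) =>
      ∫ x, B x ∂(μ : Measure (Shift r M))) :=
    ProbabilityMeasure.continuous_integral_continuousMap (⟨B, hB⟩ : C(Shift r M, ℝ))
  obtain ⟨ν, hν, hm⟩ := hcl.isCompact.exists_isMaxOn hS hc.continuousOn
  refine ⟨ν, ⟨ν.2, congrArg Subtype.val hν⟩, fun μ hμ => ?_⟩
  have := hm (show (⟨μ, hμ.1⟩ : ProbabilityMeasure (Shift r M)) ∈ S from Subtype.ext hμ.2)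
  exact this

lemma int_comp_shift {μ : Measure (Shift r M)} (hμ : InvProb μ) {f : Shift r M → ℝ}
    (hf : Continuous f) : ∫ x, f (shiftMap x) ∂μ = ∫ x, f x ∂μ := by
  conv_rhs => rw [← hμ.2]
  rw [integral_map shiftMap_cont.measurable.aemeasurable hf.measurable.aestronglyMeasurable]

/-! ### Words -/

/-- Replace the tail of `w` after position `n` by `z`. -/
def glue (w : Shift r M) (n : ℕ) (z : Shift r M)
    (h : ∀ i, i + 1 = n → M (w.1 i) (z.1 0) = true) : Shift r M :=
  ⟨fun j => if j < n then w.1 j else z.1 (j - n), fun j => by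
    by_cases h1 : j + 1 < n
    · have h2 : j < n := by omega
      simp only [h1, h2, if_true]
      exact w.2 j
    · by_cases h2 : j < n
      · have h3 : j + 1 = n := by omega
        have h4 : j + 1 - n = 0 := by omega
        simp only [h1, h2, if_true, if_false, h4]
        exact h j h3
      · have h4 : j + 1 - n = (j - n) + 1 := by omega
        simp only [h1, h2, if_false, h4]
        exact z.2 (j - n)⟩

lemma glue_lt (w : Shift r M) (n : ℕ) (z : Shift r M) (h) (j : ℕ) (hj : j < n) :
    (glue w n z h).1 j = w.1 j := by
  simp [glue, hj]

lemma glue_iter (w : Shift r M) (n : ℕ) (z : Shift r M) (h) :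
    shiftMap^[n] (glue w n z h) = z := by
  apply Subtype.ext
  funext j
  rw [iter_apply]
  simp [glue]

/-- The periodic point with period word `w_0 … w_{n-1}`. -/
def perPt (w : Shift r M) (n : ℕ) (hn : 0 < n) (h : w.1 n = w.1 0) : Shift r M :=
  ⟨fun j => w.1 (j % n), fun j => by
    have hlt := Nat.mod_lt j hn
    have h2 : (j + 1) % n = if j % n + 1 = n then 0 else j % n + 1 := by
      rw [Nat.add_mod]
      split_ifs with h3
      · rcases Nat.eq_or_lt_of_le (show 1 ≤ n from hn) with h1 | h1
        · subst h1; simp [Nat.mod_one]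
        · rw [Nat.mod_eq_of_lt h1, h3, Nat.mod_self]
      · have h1 : 1 < n := by omega
        rw [Nat.mod_eq_of_lt h1]
        exact Nat.mod_eq_of_lt (by omega)
    simp only [h2]
    split_ifs with h3
    · rw [← h]
      have := w.2 (j % n)
      rwa [h3] at this
    · exact w.2 (j % n)⟩

lemma perPt_lt (w : Shift r M) (n : ℕ) (hn : 0 < n) (h) (j : ℕ) (hj : j < n) :
    (perPt w n hn h).1 j = w.1 j := by
  simp [perPt, Nat.mod_eq_of_lt hj]

lemma perPt_iter (w : Shift r M) (n : ℕ) (hn : 0 < n) (h) :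
    shiftMap^[n] (perPt w n hn h) = perPt w n hn h := by
  apply Subtype.ext
  funext j
  rw [iter_apply]
  simp [perPt]

/-! ### Distortion and closing -/

lemma distort {Λ : ℝ} (hΛ : Λ ∈ Set.Ioo (0 : ℝ) 1) {L : ℝ} (hL : 0 ≤ L)
    {f : Shift r M → ℝ} (hf : LipBnd Λ L f) (n : ℕ) (w v : Shift r M)
    (h : ∀ j < n, w.1 j = v.1 j) :
    |birkhoffSum shiftMap f n w - birkhoffSum shiftMap f n v| ≤
      L / (1 - Λ) * shiftDist Λ (shiftMap^[n] w) (shiftMap^[n] v) := by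
  have h1Λ : 0 < 1 - Λ := by linarith [hΛ.2]
  have key : |birkhoffSum shiftMap f n w - birkhoffSum shiftMap f n v| ≤
      L / (1 - Λ) * (1 - Λ ^ n) * shiftDist Λ (shiftMap^[n] w) (shiftMap^[n] v) := by
    induction n generalizing w v with
    | zero => simp
    | succ n ih =>
      rw [birkhoffSum_succ', birkhoffSum_succ']
      have h1 := ih (shiftMap w) (shiftMap v) (fun j hj => h (j + 1) (by omega))
      have h2 := hf w v
      rw [sd_iter hΛ (n + 1) w v h] at h2
      simp only [Function.iterate_succ_apply] at h2 ⊢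
      set D := shiftDist Λ (shiftMap^[n] (shiftMap w)) (shiftMap^[n] (shiftMap v)) with hD
      have hD0 : 0 ≤ D := sd_nonneg hΛ _ _
      have h3 : L * (Λ ^ (n + 1) * D) ≤ L * (Λ ^ n * D) := by
        refine mul_le_mul_of_nonneg_left (mul_le_mul_of_nonneg_right ?_ hD0) hL
        exact pow_le_pow_of_le_one hΛ.1.le hΛ.2.le (Nat.le_succ n)
      have h4 : L / (1 - Λ) * (1 - Λ ^ (n + 1)) * D
          = L / (1 - Λ) * (1 - Λ ^ n) * D + L * (Λ ^ n * D) := by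
        field_simp
        ring
      rw [h4]
      calc _ = |(f w - f v) + (birkhoffSum shiftMap f n (shiftMap w)
              - birkhoffSum shiftMap f n (shiftMap v))| := by congr 1; ring
        _ ≤ _ := abs_add_le _ _
        _ ≤ _ := by linarith
  refine key.trans (mul_le_mul_of_nonneg_right ?_ (sd_nonneg hΛ _ _))
  have : 0 ≤ L / (1 - Λ) := by positivity
  have := pow_nonneg hΛ.1.le n
  nlinarith

lemma closing {Λ : ℝ} (hΛ : Λ ∈ Set.Ioo (0 : ℝ) 1) {L : ℝ} (hL : 0 ≤ L)
    {f : Shift r M → ℝ} (hf : LipBnd Λ L f)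
    (hmax : ∀ μ : Measure (Shift r M), InvProb μ → ∫ x, f x ∂μ ≤ 0)
    (n : ℕ) (hn : 0 < n) (w : Shift r M) (h : w.1 n = w.1 0) :
    birkhoffSum shiftMap f n w ≤ L / (1 - Λ) * shiftDist Λ w (shiftMap^[n] w) := by
  have h1Λ : 0 < 1 - Λ := by linarith [hΛ.2]
  set p := perPt w n hn h with hp
  have hpp : shiftMap^[n] p = p := perPt_iter w n hn h
  have hag : ∀ j < n, w.1 j = p.1 j := fun j hj => (perPt_lt w n hn h j hj).symm
  have h1 : birkhoffSum shiftMap f n p ≤ 0 := by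
    have := hmax _ (orb_inv n hn p hpp)
    rw [orb_integral] at this
    have hn' : (0 : ℝ) < (n : ℝ)⁻¹ := by positivity
    by_contra hc
    push Not at hc
    nlinarith [mul_pos hn' hc]
  have h2 := distort hΛ hL hf n w p hag
  have h3 : shiftDist Λ (shiftMap^[n] w) (shiftMap^[n] p) ≤ shiftDist Λ w (shiftMap^[n] w) := by
    have e1 := sd_iter hΛ n w p hag
    rw [hpp] at e1 ⊢
    have e2 := sd_ultra hΛ (shiftMap^[n] w) w p
    rw [sd_comm (shiftMap^[n] w) w] at e2
    by_contra hc
    push Not at hc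
    rcases le_max_iff.1 e2 with e3 | e3
    · linarith
    · have e4 : Λ ^ n < 1 := pow_lt_one₀ hΛ.1.le hΛ.2 hn.ne'
      have e5 := sd_nonneg hΛ w (shiftMap^[n] w)
      nlinarith
  have h4 : L / (1 - Λ) * shiftDist Λ (shiftMap^[n] w) (shiftMap^[n] p)
      ≤ L / (1 - Λ) * shiftDist Λ w (shiftMap^[n] w) :=
    mul_le_mul_of_nonneg_left h3 (by positivity)
  have := (abs_le.1 h2).2
  linarith

/-! ### Consequences of irreducibility -/

/-- The alternating point `a b a b …`. -/
def altPt (a b : Fin r) (h : M a b = true) (h' : M b a = true) : Shift r M :=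
  ⟨fun j => if j % 2 = 0 then a else b, fun j => by
    rcases Nat.mod_two_eq_zero_or_one j with h1 | h1
    · have h2 : (j + 1) % 2 = 1 := by omega
      simp [h1, h2, h]
    · have h2 : (j + 1) % 2 = 0 := by omega
      simp [h1, h2, h']⟩

lemma alt_shift (a b : Fin r) (h : M a b = true) (h' : M b a = true) :
    shiftMap (altPt a b h h') = altPt b a h' h := by
  apply Subtype.ext
  funext j
  rcases Nat.mod_two_eq_zero_or_one j with h1 | h1
  · have h2 : (j + 1) % 2 = 1 := by omega
    simp [h1, h2, altPt, shiftMap]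
  · have h2 : (j + 1) % 2 = 0 := by omega
    simp [h1, h2, altPt, shiftMap]

lemma nbr (hIrr : Irred M) (i : Fin r) : ∃ j, M i j = true := by
  obtain ⟨n, w, h0, _, h⟩ := hIrr i i
  refine ⟨w (Fin.succ 0), ?_⟩
  have := h 0
  rwa [Fin.castSucc_zero, h0] at this

lemma edge (hr : 2 ≤ r) (hIrr : Irred M) : ∃ a b : Fin r, a ≠ b ∧ M a b = true := by
  by_contra hc
  push Not at hc
  obtain ⟨n, w, h0, h1, h⟩ := hIrr ⟨0, by omega⟩ ⟨1, by omega⟩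
  have key : ∀ k : Fin (n + 2), w k = w 0 := by
    intro k
    induction k using Fin.induction with
    | zero => rfl
    | succ k ih =>
      by_contra hne
      refine hc (w k.castSucc) (w k.succ) ?_ (h k)
      rw [ih]
      exact fun e => hne e.symm
  have := key (Fin.last (n + 1))
  rw [h0, h1] at this
  simp at this

lemma connect (hSym : ∀ i j, M i j = M j i) (hIrr : Irred M) (i j : Fin r) :
    ∃ m : ℕ, ∃ u : Shift r M, u.1 0 = i ∧ u.1 (m + 1) = j := by
  obtain ⟨n, w, h0, h1, h⟩ := hIrr i j
  obtain ⟨j', hj⟩ := nbr hIrr j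
  let z : Shift r M := altPt j j' hj (by rw [hSym]; exact hj)
  have hz : z.1 0 = j := by simp [z, altPt]
  refine ⟨n, ⟨fun k => if hk : k < n + 1 then w ⟨k, by omega⟩ else z.1 (k - (n + 1)), ?_⟩, ?_, ?_⟩
  · intro k
    by_cases hk1 : k + 1 < n + 1
    · have hk2 : k < n + 1 := by omega
      simp only [hk1, hk2, dif_pos]
      exact h ⟨k, hk2⟩
    · by_cases hk2 : k < n + 1
      · have hk3 : k = n := by omega
        subst hk3
        have := h (Fin.last k)
        simp only [Fin.succ_last, h1] at this
        simp only [hk2, hk1, dif_pos, dif_neg, not_false_eq_true, Nat.sub_self, hz]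
        exact this
      · have hk3 : k + 1 - (n + 1) = (k - (n + 1)) + 1 := by omega
        simp only [hk1, hk2, dif_neg, not_false_eq_true, hk3]
        exact z.2 _
  · simpa using h0
  · simpa using hz

lemma bsum_bound (hSym : ∀ i j, M i j = M j i) (hIrr : Irred M)
    {Λ : ℝ} (hΛ : Λ ∈ Set.Ioo (0 : ℝ) 1) {L F : ℝ} (hL : 0 ≤ L) (hF : 0 ≤ F) :
    ∃ C : ℝ, 0 ≤ C ∧ ∀ f : Shift r M → ℝ, LipBnd Λ L f → (∀ x, |f x| ≤ F) →
      (∀ μ : Measure (Shift r M), InvProb μ → ∫ x, f x ∂μ ≤ 0) →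
      ∀ n w, birkhoffSum shiftMap f n w ≤ C * shiftDist Λ w (shiftMap^[n] w) := by
  have h1Λ : 0 < 1 - Λ := by linarith [hΛ.2]
  choose m u hu0 hu1 using connect hSym hIrr
  obtain ⟨D, hD⟩ := Set.Finite.bddAbove
    (Set.finite_range (fun q : Fin r × Fin r => m q.1 q.2 + 1))
  have hD' : ∀ i j, ((m i j + 1 : ℕ) : ℝ) ≤ D := fun i j => by
    exact_mod_cast hD ⟨(i, j), rfl⟩
  set E := L / (1 - Λ) with hE
  have hE0 : 0 ≤ E := by positivity
  have hDF : 0 ≤ (D : ℝ) * F := by positivity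
  refine ⟨2 * E + D * F, by positivity, fun f hf hfF hmax n w => ?_⟩
  have hd0 := sd_nonneg hΛ w (shiftMap^[n] w)
  rcases Nat.eq_zero_or_pos n with hn | hn
  · subst hn
    simp [sd_self]
  by_cases hw : w.1 n = w.1 0
  · have := closing hΛ hL hf hmax n hn w hw
    rw [← hE] at this
    nlinarith
  · have hd : shiftDist Λ w (shiftMap^[n] w) = 1 := by
      apply sd_head_ne
      rw [iter_apply, Nat.zero_add]
      exact fun e => hw e.symm
    rw [hd, mul_one]
    set z := u (w.1 n) (w.1 0) with hz
    set k := m (w.1 n) (w.1 0) with hk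
    have hg : ∀ i, i + 1 = n → M (w.1 i) (z.1 0) = true := by
      intro i hi
      rw [hz, hu0, ← hi]
      exact w.2 i
    set v := glue w n z hg with hv
    have hvi : shiftMap^[n] v = z := glue_iter w n z hg
    have hag : ∀ j < n, w.1 j = v.1 j := fun j hj => (glue_lt w n z hg j hj).symm
    have hv0 : v.1 (n + (k + 1)) = v.1 0 := by
      have h1 : (shiftMap^[n] v).1 (k + 1) = v.1 (k + 1 + n) := iter_apply _ _ _
      rw [Nat.add_comm, ← h1, hvi, hz, hk, hu1]
      exact hag 0 hn
    have c1 := closing hΛ hL hf hmax (n + (k + 1)) (by omega) v hv0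
    rw [birkhoffSum_add, hvi] at c1
    have c2 := sd_le_one hΛ v (shiftMap^[n + (k + 1)] v)
    have c3 : |birkhoffSum shiftMap f (k + 1) z| ≤ (k + 1 : ℕ) * F := by
      unfold birkhoffSum
      refine (Finset.abs_sum_le_sum_abs _ _).trans ?_
      refine (Finset.sum_le_sum fun i _ => hfF _).trans ?_
      simp
    have c4 := distort hΛ hL hf n w v hag
    have c5 := sd_le_one hΛ (shiftMap^[n] w) (shiftMap^[n] v)
    have c6 := mul_le_mul_of_nonneg_right (hD' (w.1 n) (w.1 0)) hF
    rw [← hE] at c1 c4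
    have c7 := (abs_le.1 c3).1
    have c8 := (abs_le.1 c4).2
    have c9 := mul_le_mul_of_nonneg_left c2 hE0
    have c10 := mul_le_mul_of_nonneg_left c5 hE0
    linarith

/-! ### The sub-action -/

/-- The sub-action `U(z) = sup { S_n f(w) - K d(w, x̄) : σ^n w = z }`. -/
noncomputable def subAct (Λ : ℝ) (f : Shift r M → ℝ) (xb : Shift r M) (K : ℝ)
    (z : Shift r M) : ℝ :=
  ⨆ q : {q : ℕ × Shift r M // shiftMap^[q.1] q.2 = z},
    (birkhoffSum shiftMap f q.1.1 q.1.2 - K * shiftDist Λ q.1.2 xb)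

section SubAct

variable {Λ L C K : ℝ} {f : Shift r M → ℝ}

lemma term_le (hΛ : Λ ∈ Set.Ioo (0 : ℝ) 1) (hC : 0 ≤ C) (hK : 0 ≤ K)
    (hS : ∀ n w, birkhoffSum shiftMap f n w ≤ C * shiftDist Λ w (shiftMap^[n] w))
    (xb : Shift r M) (n : ℕ) (w : Shift r M) :
    birkhoffSum shiftMap f n w - K * shiftDist Λ w xb ≤ C := by
  have h1 := hS n w
  have h2 := mul_le_mul_of_nonneg_left (sd_le_one hΛ w (shiftMap^[n] w)) hC
  have h3 := mul_nonneg hK (sd_nonneg hΛ w xb)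
  linarith

lemma sub_bdd (hΛ : Λ ∈ Set.Ioo (0 : ℝ) 1) (hC : 0 ≤ C) (hK : 0 ≤ K)
    (hS : ∀ n w, birkhoffSum shiftMap f n w ≤ C * shiftDist Λ w (shiftMap^[n] w))
    (xb z : Shift r M) :
    BddAbove (Set.range fun q : {q : ℕ × Shift r M // shiftMap^[q.1] q.2 = z} =>
      (birkhoffSum shiftMap f q.1.1 q.1.2 - K * shiftDist Λ q.1.2 xb)) := by
  refine ⟨C, ?_⟩
  rintro _ ⟨q, rfl⟩
  exact term_le hΛ hC hK hS xb _ _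

lemma le_sub (hΛ : Λ ∈ Set.Ioo (0 : ℝ) 1) (hC : 0 ≤ C) (hK : 0 ≤ K)
    (hS : ∀ n w, birkhoffSum shiftMap f n w ≤ C * shiftDist Λ w (shiftMap^[n] w))
    (xb z : Shift r M) (n : ℕ) (w : Shift r M) (h : shiftMap^[n] w = z) :
    birkhoffSum shiftMap f n w - K * shiftDist Λ w xb ≤ subAct Λ f xb K z :=
  le_ciSup (sub_bdd hΛ hC hK hS xb z) ⟨(n, w), h⟩

lemma sub_le (xb z : Shift r M) (t : ℝ)
    (h : ∀ n w, shiftMap^[n] w = z → birkhoffSum shiftMap f n w - K * shiftDist Λ w xb ≤ t) :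
    subAct Λ f xb K z ≤ t := by
  have : Nonempty {q : ℕ × Shift r M // shiftMap^[q.1] q.2 = z} := ⟨⟨(0, z), rfl⟩⟩
  exact ciSup_le fun q => h q.1.1 q.1.2 q.2

lemma sub_abs (hΛ : Λ ∈ Set.Ioo (0 : ℝ) 1) (hC : 0 ≤ C) (hK : 0 ≤ K)
    (hS : ∀ n w, birkhoffSum shiftMap f n w ≤ C * shiftDist Λ w (shiftMap^[n] w))
    (xb z : Shift r M) : |subAct Λ f xb K z| ≤ C + K := by
  rw [abs_le]
  constructor
  · have h1 := le_sub hΛ hC hK hS xb z 0 z rfl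
    have h2 := mul_le_mul_of_nonneg_left (sd_le_one hΛ z xb) hK
    rw [birkhoffSum_zero] at h1
    linarith
  · exact (sub_le xb z C fun n w _ => term_le hΛ hC hK hS xb n w).trans (by linarith)

lemma sub_ineq (hΛ : Λ ∈ Set.Ioo (0 : ℝ) 1) (hC : 0 ≤ C) (hK : 0 ≤ K)
    (hS : ∀ n w, birkhoffSum shiftMap f n w ≤ C * shiftDist Λ w (shiftMap^[n] w))
    (xb x : Shift r M) :
    f x + subAct Λ f xb K x - subAct Λ f xb K (shiftMap x) ≤ 0 := by
  have : subAct Λ f xb K x ≤ subAct Λ f xb K (shiftMap x) - f x := by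
    refine sub_le xb x _ fun n w h => ?_
    have := le_sub hΛ hC hK hS xb (shiftMap x) (n + 1) w
      (by rw [Function.iterate_succ_apply', h])
    rw [birkhoffSum_succ, h] at this
    linarith
  linarith

lemma sub_lip (hΛ : Λ ∈ Set.Ioo (0 : ℝ) 1) (hL : 0 ≤ L) (hC : 0 ≤ C) (hK : 0 ≤ K)
    (hf : LipBnd Λ L f)
    (hS : ∀ n w, birkhoffSum shiftMap f n w ≤ C * shiftDist Λ w (shiftMap^[n] w))
    (xb : Shift r M) : LipBnd Λ (L / (1 - Λ) + 2 * C + 2 * K) (subAct Λ f xb K) := by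
  have h1Λ : 0 < 1 - Λ := by linarith [hΛ.2]
  set E := L / (1 - Λ) with hE
  have hE0 : 0 ≤ E := by positivity
  have key : ∀ z z' : Shift r M, z.1 0 = z'.1 0 →
      subAct Λ f xb K z ≤ subAct Λ f xb K z' + (E + 2 * C + 2 * K) * shiftDist Λ z z' := by
    intro z z' h0
    refine sub_le xb z _ fun n w h => ?_
    have hg : ∀ i, i + 1 = n → M (w.1 i) (z'.1 0) = true := by
      intro i hi
      rw [← h0, ← h, iter_apply, Nat.zero_add, ← hi]
      exact w.2 i
    set v := glue w n z' hg with hv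
    have hvi : shiftMap^[n] v = z' := glue_iter w n z' hg
    have hag : ∀ j < n, w.1 j = v.1 j := fun j hj => (glue_lt w n z' hg j hj).symm
    have h1 := le_sub hΛ hC hK hS xb z' n v hvi
    have h2 := distort hΛ hL hf n w v hag
    have h3 := sd_iter hΛ n w v hag
    rw [h, hvi] at h2 h3
    rw [← hE] at h2
    have h4 := sd_lip hΛ xb w v
    have hd := sd_nonneg hΛ z z'
    have h5 : shiftDist Λ w v ≤ shiftDist Λ z z' := by
      rw [h3]
      have : Λ ^ n ≤ 1 := pow_le_one₀ hΛ.1.le hΛ.2.le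
      nlinarith
    have h6 := (abs_le.1 h2).2
    have h7 := (abs_le.1 h4).1
    rw [one_mul] at h7
    have h8 : K * shiftDist Λ v xb ≤ K * (shiftDist Λ w xb + shiftDist Λ z z') :=
      mul_le_mul_of_nonneg_left (by linarith) hK
    have h9 := mul_nonneg hK hd
    have h10 := mul_nonneg hC hd
    nlinarith
  intro z z'
  by_cases h0 : z.1 0 = z'.1 0
  · have h1 := key z z' h0
    have h2 := key z' z h0.symm
    rw [sd_comm z' z] at h2
    rw [abs_le]
    constructor <;> linarith
  · rw [sd_head_ne z z' h0]
    have h1 := abs_le.1 (sub_abs hΛ hC hK hS xb z)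
    have h2 := abs_le.1 (sub_abs hΛ hC hK hS xb z')
    rw [abs_le]
    constructor <;> linarith [h1.1, h1.2, h2.1, h2.2]

/-- The sub-action is tight at `x̄` as soon as `x̄_0 ≠ x̄_1` and `K` is large. -/
lemma sub_eq {F : ℝ} (hΛ : Λ ∈ Set.Ioo (0 : ℝ) 1) (hL : 0 ≤ L) (hC : 0 ≤ C)
    (hF : ∀ x, |f x| ≤ F)
    (hK : K = L + C / Λ + C + F) (hf : LipBnd Λ L f)
    (hS : ∀ n w, birkhoffSum shiftMap f n w ≤ C * shiftDist Λ w (shiftMap^[n] w))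
    (xb : Shift r M) (hxb : xb.1 0 ≠ xb.1 1) :
    f xb + subAct Λ f xb K xb - subAct Λ f xb K (shiftMap xb) = 0 := by
  have hF0 : 0 ≤ F := (abs_nonneg _).trans (hF xb)
  have hCΛ : 0 ≤ C / Λ := div_nonneg hC hΛ.1.le
  have hK0 : 0 ≤ K := by rw [hK]; positivity
  have hfx := abs_le.1 (hF xb)
  refine le_antisymm (sub_ineq hΛ hC hK0 hS xb xb) ?_
  have h0 := le_sub hΛ hC hK0 hS xb xb 0 xb rfl
  rw [birkhoffSum_zero, sd_self] at h0
  suffices h : subAct Λ f xb K (shiftMap xb) ≤ f xb by linarith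
  refine sub_le xb _ _ fun n w h => ?_
  by_cases hw : w.1 0 = xb.1 0
  · cases n with
    | zero =>
      exfalso
      simp only [Function.iterate_zero, id] at h
      rw [h] at hw
      exact hxb hw.symm
    | succ n =>
      rw [Function.iterate_succ_apply] at h
      rw [birkhoffSum_succ']
      have h1 := hS n (shiftMap w)
      rw [h] at h1
      have h2 := sd_shift hΛ w xb hw
      have h3 := (abs_le.1 (hf w xb)).2
      have h4 : shiftDist Λ (shiftMap w) (shiftMap xb) = shiftDist Λ w xb / Λ := by
        rw [h2]; field_simp [hΛ.1.ne']
      rw [h4] at h1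
      have h5 := sd_nonneg hΛ w xb
      have h6 : C * (shiftDist Λ w xb / Λ) = C / Λ * shiftDist Λ w xb := by ring
      rw [h6] at h1
      have h7 := mul_nonneg hC h5
      have h8 := mul_nonneg hF0 h5
      rw [hK]
      nlinarith
  · rw [sd_head_ne w xb hw, mul_one]
    have h1 := hS n w
    have h2 := mul_le_mul_of_nonneg_left (sd_le_one hΛ w (shiftMap^[n] w)) hC
    rw [hK]
    linarith [hfx.1]

end SubAct

/-! ### Entropy bounds and the limit of the effective constants -/

lemma negMulLog_le_one' {x : ℝ} (h0 : 0 ≤ x) : Real.negMulLog x ≤ 1 := by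
  rcases h0.eq_or_lt with h | h
  · rw [← h]; simp
  · have h1 := Real.one_sub_inv_le_log_of_pos h
    have h2 := mul_le_mul_of_nonneg_left h1 h.le
    have h3 : x * (1 - x⁻¹) = x - 1 := by field_simp
    rw [Real.negMulLog]
    linarith

lemma cylEnt_nonneg {μ : Measure (Shift r M)} (hμ : InvProb μ) (n : ℕ) : 0 ≤ cylEnt μ n := by
  have := hμ.1
  refine Finset.sum_nonneg fun w _ => Real.negMulLog_nonneg ENNReal.toReal_nonneg ?_
  exact measureReal_le_one

lemma ent_nonneg {μ : Measure (Shift r M)} (hμ : InvProb μ) : 0 ≤ entropy μ :=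
  Real.iInf_nonneg fun n => div_nonneg (cylEnt_nonneg hμ _) (by positivity)

lemma ent_le {μ : Measure (Shift r M)} (hμ : InvProb μ) : entropy μ ≤ r := by
  have hb : BddBelow (Set.range fun n : ℕ => cylEnt μ (n + 1) / ((n : ℝ) + 1)) := by
    refine ⟨0, ?_⟩
    rintro _ ⟨n, rfl⟩
    exact div_nonneg (cylEnt_nonneg hμ _) (by positivity)
  refine (ciInf_le hb 0).trans ?_
  have : cylEnt μ (0 + 1) ≤ r := by
    unfold cylEnt
    refine (Finset.sum_le_sum fun w _ => negMulLog_le_one' ENNReal.toReal_nonneg).trans ?_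
    simp
  simpa using this

lemma le_maxErg {B : Shift r M → ℝ} (hB : Continuous B) {μ : Measure (Shift r M)}
    (hμ : InvProb μ) : ∫ x, B x ∂μ ≤ maxErg B := by
  obtain ⟨ν, _, h⟩ := max_exists ⟨μ, hμ⟩ hB
  refine le_csSup ⟨∫ x, B x ∂ν, ?_⟩ ⟨μ, hμ, rfl⟩
  rintro _ ⟨μ', h', rfl⟩
  exact h μ' h'

lemma maxErg_attained (hne : ∃ μ : Measure (Shift r M), InvProb μ) {B : Shift r M → ℝ}
    (hB : Continuous B) : ∃ ν : Measure (Shift r M), InvProb ν ∧ ∫ x, B x ∂ν = maxErg B := by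
  obtain ⟨ν, hν, h⟩ := max_exists hne hB
  refine ⟨ν, hν, le_antisymm (le_maxErg hB hν) ?_⟩
  refine csSup_le ⟨_, ν, hν, rfl⟩ ?_
  rintro _ ⟨μ', h', rfl⟩
  exact h μ' h'

lemma maxErg_le (hne : ∃ μ : Measure (Shift r M), InvProb μ) {B B' : Shift r M → ℝ}
    (hB : Continuous B) (hB' : Continuous B') {s : ℝ} (h : ∀ x, B x ≤ B' x + s) :
    maxErg B ≤ maxErg B' + s := by
  obtain ⟨ν, hν, e⟩ := maxErg_attained hne hB
  have := hν.1
  rw [← e]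
  calc ∫ x, B x ∂ν ≤ ∫ x, (B' x + s) ∂ν :=
        integral_mono (cont_int hB ν) (cont_int (hB'.add continuous_const) ν) h
    _ = ∫ x, B' x ∂ν + s := by
        rw [integral_add (cont_int hB' ν) (integrable_const s)]; simp
    _ ≤ _ := by linarith [le_maxErg hB' hν]

lemma Gplus_bounds (hne : ∃ μ : Measure (Shift r M), InvProb μ)
    {A : Shift r M → Shift r M → ℝ} (y : Shift r M) (hA : Continuous (A y))
    {φ : Shift r M → ℝ} (hφ : Continuous φ) {β : ℝ} (hβ : 0 < β) :
    maxErg (fun x => A y x + φ x / β) ≤ Gplus (fun y x => β * A y x) φ y / β ∧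
    Gplus (fun y x => β * A y x) φ y / β ≤ maxErg (fun x => A y x + φ x / β) + r / β := by
  have hB : Continuous (fun x => A y x + φ x / β) := hA.add (hφ.div_const β)
  have hI : ∀ μ : Measure (Shift r M), ∫ x, (β * A y x + φ x) ∂μ
      = β * ∫ x, (A y x + φ x / β) ∂μ := by
    intro μ
    rw [← integral_const_mul]
    congr 1
    funext x
    field_simp
  have hub : ∀ t ∈ {t : ℝ | ∃ μ : Measure (Shift r M), InvProb μ ∧
      t = ∫ x, (β * A y x + φ x) ∂μ + entropy μ},
      t ≤ β * maxErg (fun x => A y x + φ x / β) + r := by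
    rintro _ ⟨μ, hμ, rfl⟩
    rw [hI]
    have h1 := mul_le_mul_of_nonneg_left (le_maxErg hB hμ) hβ.le
    linarith [ent_le hμ]
  obtain ⟨ν, hν, e⟩ := maxErg_attained hne hB
  constructor
  · rw [le_div_iff₀ hβ]
    refine le_trans ?_ (le_csSup ⟨_, hub⟩ ⟨ν, hν, rfl⟩)
    simp only [hI, e]
    linarith [ent_nonneg hν]
  · rw [div_le_iff₀ hβ, add_mul, div_mul_cancel₀ _ hβ.ne']
    have : Gplus (fun y x => β * A y x) φ y ≤ β * maxErg (fun x => A y x + φ x / β) + r :=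
      csSup_le ⟨_, ν, hν, rfl⟩ hub
    linarith

lemma limit_const {Λ : ℝ} (hΛ : Λ ∈ Set.Ioo (0 : ℝ) 1)
    (hne : ∃ μ : Measure (Shift r M), InvProb μ)
    (A : Shift r M → Shift r M → ℝ) (hA : ∀ y, Continuous (A y))
    (y0 : Shift r M)
    (φ : ℝ → Shift r M → ℝ) (lam : ℝ → ℝ)
    (heff : ∀ β > (0 : ℝ), IsLip Λ (φ β) ∧ φ β y0 = 0 ∧
      ∀ y, Gplus (fun y x => β * A y x) (φ β) y = φ β y + lam β)
    (b : ℕ → ℝ) (hb : ∀ n, 0 < b n) (hbtop : Filter.Tendsto b Filter.atTop Filter.atTop)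
    (V : Shift r M → ℝ)
    (hV : TendstoUniformly (fun n x => φ (b n) x / b n) V Filter.atTop) :
    Continuous V ∧ ∃ c : ℝ, (∀ y, maxErg (fun x => A y x + V x - V y) = c) ∧
      Filter.Tendsto (fun β => lam β / β) Filter.atTop (𝓝 c) := by
  have hφ : ∀ β > (0 : ℝ), Continuous (φ β) := fun β hβ => by
    obtain ⟨⟨K, hK⟩, _⟩ := heff β hβ
    exact lip_cont hΛ hK
  have hVc : Continuous V := hV.continuous
    (Filter.Frequently.of_forall fun n => (hφ (b n) (hb n)).div_const _)
  have hBc : ∀ y, Continuous (fun x => A y x + V x - V y) := fun y =>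
    ((hA y).add hVc).sub continuous_const
  have hBβ : ∀ β > (0 : ℝ), ∀ y, Continuous (fun x => A y x + φ β x / β) := fun β hβ y =>
    (hA y).add ((hφ β hβ).div_const _)
  have hG : ∀ β > (0 : ℝ), ∀ y,
      maxErg (fun x => A y x + φ β x / β) ≤ φ β y / β + lam β / β ∧
      φ β y / β + lam β / β ≤ maxErg (fun x => A y x + φ β x / β) + r / β := by
    intro β hβ y
    have := Gplus_bounds hne y (hA y) (hφ β hβ) hβ
    rwa [(heff β hβ).2.2 y, add_div] at this
  have hr0 : (0 : ℝ) ≤ r := Nat.cast_nonneg r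
  have hrb : Filter.Tendsto (fun β : ℝ => (r : ℝ) / β) Filter.atTop (𝓝 0) :=
    tendsto_const_nhds.div_atTop tendsto_id
  have hl : ∀ y, Filter.Tendsto (fun n => lam (b n) / b n) Filter.atTop
      (𝓝 (maxErg (fun x => A y x + V x - V y))) := by
    intro y
    rw [Metric.tendsto_nhds]
    intro ε hε
    have e1 := Metric.tendstoUniformly_iff.1 hV (ε / 4) (by linarith)
    have e2 := (hrb.comp hbtop).eventually (gt_mem_nhds (show (0 : ℝ) < ε / 4 by linarith))
    filter_upwards [e1, e2] with n h1 h2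
    simp only [Function.comp] at h2
    obtain ⟨g1, g2⟩ := hG (b n) (hb n) y
    have h1' : ∀ x, -(ε / 4) < V x - φ (b n) x / b n ∧ V x - φ (b n) x / b n < ε / 4 := by
      intro x
      have := h1 x
      rw [Real.dist_eq] at this
      exact abs_lt.1 this
    have m1 := maxErg_le hne (hBc y) (hBβ (b n) (hb n) y) (s := ε / 4 - V y)
      (fun x => by linarith [(h1' x).2])
    have m2 := maxErg_le hne (hBβ (b n) (hb n) y) (hBc y) (s := ε / 4 + V y)
      (fun x => by linarith [(h1' x).1])
    have hy := h1' y
    rw [Real.dist_eq, abs_lt]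
    constructor <;> linarith [hy.1, hy.2]
  refine ⟨hVc, maxErg (fun x => A y0 x + V x - V y0), fun y => tendsto_nhds_unique (hl y) (hl y0),
    ?_⟩
  set c := maxErg (fun x => A y0 x + V x - V y0) with hc
  have hcy : ∀ y, maxErg (fun x => A y x + V x - V y) = c :=
    fun y => tendsto_nhds_unique (hl y) (hl y0)
  have hbd : ∀ β > (0 : ℝ), c ≤ lam β / β ∧ lam β / β ≤ c + r / β := by
    intro β hβ
    have hWc : Continuous (fun x => φ β x / β - V x) := ((hφ β hβ).div_const _).sub hVc
    obtain ⟨y1, -, h1⟩ := isCompact_univ.exists_isMaxOn ⟨y0, trivial⟩ hWc.continuousOn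
    obtain ⟨y2, -, h2⟩ := isCompact_univ.exists_isMinOn ⟨y0, trivial⟩ hWc.continuousOn
    have h1' : ∀ x, φ β x / β - V x ≤ φ β y1 / β - V y1 := fun x => h1 (Set.mem_univ x)
    have h2' : ∀ x, φ β y2 / β - V y2 ≤ φ β x / β - V x := fun x => h2 (Set.mem_univ x)
    constructor
    · have m1 := maxErg_le hne (hBc y2) (hBβ β hβ y2) (s := -(φ β y2 / β - V y2) - V y2)
        (fun x => by linarith [h2' x])
      rw [hcy] at m1
      linarith [(hG β hβ y2).1]
    · have m1 := maxErg_le hne (hBβ β hβ y1) (hBc y1) (s := (φ β y1 / β - V y1) + V y1)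
        (fun x => by linarith [h1' x])
      rw [hcy] at m1
      linarith [(hG β hβ y1).2]
  have hup : Filter.Tendsto (fun β : ℝ => c + (r : ℝ) / β) Filter.atTop (𝓝 c) := by
    simpa using hrb.const_add c
  refine tendsto_of_tendsto_of_tendsto_of_le_of_le' tendsto_const_nhds hup ?_ ?_
  · filter_upwards [Filter.eventually_gt_atTop 0] with β hβ using (hbd β hβ).1
  · filter_upwards [Filter.eventually_gt_atTop 0] with β hβ using (hbd β hβ).2

/-- With `φ⁺_β` the forward effective potential for `βA` (normalized
by `φ⁺_β(y⁰) = 0`) and `λ⁺_β` the effective constant, assume `φ⁺_{β_n}/β_n → V`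
uniformly for some sequence `β_n → ∞`. Then there is a family `{U_y}` of sub-actions
with respect to `A(y,·) + V − V(y)` (i.e. each `U_y` is Lipschitz, satisfies
`A(y,x) + V(x) − V(y) + U_y(x) − U_y(σx) ≤ max_{μ ∈ M_σ} ∫ (A(y,·) + V − V(y)) dμ`
everywhere, with equality on the support of some maximizing measure) such that the map
`(y,x) ↦ A(y,x) + U_y(x) − U_y(σx)` is Borel measurable and bounded, and
`lim_{β→∞} λ⁺_β/β = sup { ∬ (A(y,x) + U_y(x) − U_y(σx)) dη̂ }`, the supremum running
over Borel probabilities `η̂` on `Σ̂_M` whose two marginals coincide under the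
identification `Σ*_M ≅ Σ_M`. -/
theorem effective_constant_is_ergodic_transshipment
    (r : ℕ) (hr : 2 ≤ r) (M : Fin r → Fin r → Bool)
    (hSym : ∀ i j, M i j = M j i) (hIrr : Irred M)
    (Λ : ℝ) (hΛ : Λ ∈ Set.Ioo (0 : ℝ) 1)
    (A : Shift r M → Shift r M → ℝ) (hA : IsLip2 Λ A)
    (y0 : Shift r M)
    (φ : ℝ → Shift r M → ℝ) (lam : ℝ → ℝ)
    (heff : ∀ β > (0 : ℝ), IsLip Λ (φ β) ∧ φ β y0 = 0 ∧
      ∀ y, Gplus (fun y x => β * A y x) (φ β) y = φ β y + lam β)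
    (b : ℕ → ℝ) (hb : ∀ n, 0 < b n) (hbtop : Filter.Tendsto b Filter.atTop Filter.atTop)
    (V : Shift r M → ℝ)
    (hV : TendstoUniformly (fun n x => φ (b n) x / b n) V Filter.atTop) :
    ∃ U : Shift r M → Shift r M → ℝ,
      -- each U_y is a sub-action with respect to A(y,·) + V − V(y)
      (∀ y : Shift r M, IsLip Λ (U y) ∧
        (∀ x : Shift r M, (A y x + V x - V y) + U y x - U y (shiftMap x) ≤
          maxErg (fun x => A y x + V x - V y)) ∧
        (∃ ν : Measure (Shift r M), InvProb ν ∧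
          (∫ x, (A y x + V x - V y) ∂ν = maxErg (fun x => A y x + V x - V y)) ∧
          (∀ᵐ x ∂ν, (A y x + V x - V y) + U y x - U y (shiftMap x) =
            maxErg (fun x => A y x + V x - V y)))) ∧
      -- the cost map (y,x) ↦ A(y,x) + U_y(x) − U_y(σx) is Borel measurable and bounded
      Measurable (fun p : Shift r M × Shift r M =>
        A p.1 p.2 + U p.1 p.2 - U p.1 (shiftMap p.2)) ∧
      (∃ Cb : ℝ, ∀ p : Shift r M × Shift r M,
        |A p.1 p.2 + U p.1 p.2 - U p.1 (shiftMap p.2)| ≤ Cb) ∧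
      -- lim λ⁺_β/β equals the value of the ergodic transshipment problem
      Filter.Tendsto (fun β => lam β / β) Filter.atTop (𝓝 (sSup
        {t : ℝ | ∃ η : Measure (Shift r M × Shift r M), IsProbabilityMeasure η ∧
          η {p : Shift r M × Shift r M | M (p.1.1 0) (p.2.1 0) = true}ᶜ = 0 ∧
          η.map Prod.fst = η.map Prod.snd ∧
          t = ∫ p, (A p.1 p.2 + U p.1 p.2 - U p.1 (shiftMap p.2)) ∂η})) := by
  obtain ⟨KA0, hKA0⟩ := hA
  obtain ⟨a, b', hab, hMab⟩ := edge hr hIrr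
  have hMba : M b' a = true := by rw [hSym]; exact hMab
  set p : Shift r M := altPt a b' hMab hMba with hp
  set q : Shift r M := altPt b' a hMba hMab with hq
  have hpq : shiftMap p = q := alt_shift _ _ _ _
  have hqp : shiftMap q = p := alt_shift _ _ _ _
  have hpp : shiftMap^[2] p = p := by
    rw [Function.iterate_succ_apply, Function.iterate_one, hpq, hqp]
  have hμ0 : InvProb (orbMeas 2 p) := orb_inv 2 (by norm_num) p hpp
  have hne : ∃ μ : Measure (Shift r M), InvProb μ := ⟨_, hμ0⟩
  have hA2c := lip2_cont hΛ hKA0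
  have hAc : ∀ y, Continuous (A y) := fun y => hA2c.comp (Continuous.prodMk_right y)
  obtain ⟨hVc, c, hcy, hlim⟩ := limit_const hΛ hne A hAc y0 φ lam heff b hb hbtop V hV
  have hBc : ∀ y, Continuous (fun x => A y x + V x - V y) := fun y =>
    ((hAc y).add hVc).sub continuous_const
  set KA := max KA0 0 with hKA
  have hKA_nonneg : 0 ≤ KA := le_max_right _ _
  have hA' : ∀ y x y' x', |A y x - A y' x'| ≤ KA * max (shiftDist Λ y y') (shiftDist Λ x x') :=
    fun y x y' x' => (hKA0 y x y' x').trans (mul_le_mul_of_nonneg_right (le_max_left _ _)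
      (le_max_of_le_left (sd_nonneg hΛ _ _)))
  have hVhalf : ∀ y y', V y - V y' ≤ KA * shiftDist Λ y y' := by
    intro y y'
    have := maxErg_le hne (hBc y) (hBc y') (s := KA * shiftDist Λ y y' - (V y - V y')) (fun x => by
      have h1 := (abs_le.1 (hA' y x y' x)).2
      rw [sd_self, max_eq_left (sd_nonneg hΛ _ _)] at h1
      linarith)
    rw [hcy, hcy] at this
    linarith
  have hVL : LipBnd Λ KA V := fun y y' => by
    rw [abs_le]
    have h1 := hVhalf y y'
    have h2 := hVhalf y' y
    rw [sd_comm y' y] at h2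
    constructor <;> linarith
  obtain ⟨FA, hFA⟩ := isCompact_univ.exists_bound_of_continuousOn
    (f := fun s : Shift r M × Shift r M => A s.1 s.2) hA2c.continuousOn
  have hFA' : ∀ y x, |A y x| ≤ FA := fun y x => hFA (y, x) trivial
  obtain ⟨FV, hFV0, hFV⟩ := cont_bdd hVc
  have hFA0 : 0 ≤ FA := (abs_nonneg _).trans (hFA' y0 y0)
  set f : Shift r M → Shift r M → ℝ := fun y x => A y x + V x - V y - c with hf
  set L := 2 * KA with hL
  set F := FA + 2 * FV + |c| with hF
  have hL0 : 0 ≤ L := by positivity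
  have hF0 : 0 ≤ F := by positivity
  have hfL : ∀ y, LipBnd Λ L (f y) := by
    intro y x x'
    have h1 := hA' y x y x'
    rw [sd_self, max_eq_right (sd_nonneg hΛ _ _)] at h1
    have h2 := hVL x x'
    calc |f y x - f y x'| = |(A y x - A y x') + (V x - V x')| := by
          simp only [hf]; congr 1; ring
      _ ≤ _ := abs_add_le _ _
      _ ≤ L * shiftDist Λ x x' := by rw [hL]; linarith
  have hfc : ∀ y, Continuous (f y) := fun y => lip_cont hΛ (hfL y)
  have hfF : ∀ y x, |f y x| ≤ F := by
    intro y x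
    have h1 := abs_le.1 (hFA' y x)
    have h2 := abs_le.1 (hFV x)
    have h3 := abs_le.1 (hFV y)
    have h4 := le_abs_self c
    have h5 := neg_abs_le c
    simp only [hf, hF]
    rw [abs_le]
    constructor <;> linarith [h1.1, h1.2, h2.1, h2.2, h3.1, h3.2]
  have hfmax : ∀ y, ∀ μ : Measure (Shift r M), InvProb μ → ∫ x, f y x ∂μ ≤ 0 := by
    intro y μ hμ
    have := hμ.1
    have h1 := le_maxErg (hBc y) hμ
    rw [hcy] at h1
    simp only [hf]
    rw [integral_sub (cont_int (hBc y) μ) (integrable_const c)]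
    simp only [integral_const, probReal_univ, one_smul]
    linarith
  obtain ⟨C, hC0, hC⟩ := bsum_bound (M := M) hSym hIrr hΛ hL0 hF0
  have hS : ∀ y n w, birkhoffSum shiftMap (f y) n w ≤ C * shiftDist Λ w (shiftMap^[n] w) :=
    fun y => hC (f y) (hfL y) (hfF y) (hfmax y)
  set K := L + C / Λ + C + F with hK
  have hCΛ : 0 ≤ C / Λ := div_nonneg hC0 hΛ.1.le
  have hK0 : 0 ≤ K := by positivity
  let sel : Fin r → Shift r M := fun i => if i = a then q else p
  let U : Shift r M → Shift r M → ℝ := fun y => subAct Λ (f y) (sel (y.1 0)) K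
  have hUlip : ∀ y, LipBnd Λ (L / (1 - Λ) + 2 * C + 2 * K) (U y) := fun y =>
    sub_lip hΛ hL0 hC0 hK0 (hfL y) (hS y) _
  have hUc : ∀ y, Continuous (U y) := fun y => lip_cont hΛ (hUlip y)
  have hUabs : ∀ y z, |U y z| ≤ C + K := fun y z => sub_abs hΛ hC0 hK0 (hS y) _ z
  have hUineq : ∀ y x, f y x + U y x - U y (shiftMap x) ≤ 0 := fun y x =>
    sub_ineq hΛ hC0 hK0 (hS y) _ x
  have hsel_ne : ∀ i, (sel i).1 0 ≠ (sel i).1 1 := by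
    intro i
    simp only [sel]
    split_ifs
    · simpa [hq, altPt] using hab.symm
    · simpa [hp, altPt] using hab
  have hUeq : ∀ y, f y (sel (y.1 0)) + U y (sel (y.1 0)) - U y (shiftMap (sel (y.1 0))) = 0 :=
    fun y => sub_eq hΛ hL0 hC0 (hfF y) hK (hfL y) (hS y) _ (hsel_ne _)
  have hselp : sel (p.1 0) = q := by simp [sel, hp, altPt]
  have hselq : sel (q.1 0) = p := by simp [sel, hq, altPt, hab.symm]
  -- measurability in `y`
  have hUmeas1 : ∀ z, Measurable (fun y => U y z) := by
    intro z
    apply LowerSemicontinuous.measurable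
    have : (fun y => U y z) = fun y => ⨆ s : {s : ℕ × Shift r M // shiftMap^[s.1] s.2 = z},
        (birkhoffSum shiftMap (f y) s.1.1 s.1.2 - K * shiftDist Λ s.1.2 (sel (y.1 0))) := rfl
    rw [this]
    refine lowerSemicontinuous_ciSup (fun y => sub_bdd hΛ hC0 hK0 (hS y) _ z) fun s => ?_
    apply Continuous.lowerSemicontinuous
    refine Continuous.sub ?_ (continuous_const.mul ?_)
    · unfold birkhoffSum
      refine continuous_finsetSum _ fun i _ => ?_
      simp only [hf]
      have h1 : Continuous (fun y => A y (shiftMap^[i] s.1.2)) :=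
        hA2c.comp (Continuous.prodMk_left _)
      exact ((h1.add continuous_const).sub hVc).sub continuous_const
    · have h1 : Continuous (fun i : Fin r => shiftDist Λ s.1.2 (sel i)) :=
        continuous_of_discreteTopology
      have h2 : Continuous (fun y : Shift r M => y.1 0) :=
        (continuous_apply 0).comp continuous_subtype_val
      exact h1.comp h2
  have hUmeas : Measurable (fun s : Shift r M × Shift r M => U s.2 s.1) :=
    measurable_uncurry_of_continuous_of_measurable (u := fun z y => U y z)
      (fun y => hUc y) hUmeas1
  have hσm : Measurable (shiftMap : Shift r M → Shift r M) := shiftMap_cont.measurable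
  have hGm : Measurable (fun s : Shift r M × Shift r M =>
      A s.1 s.2 + U s.1 s.2 - U s.1 (shiftMap s.2)) := by
    refine (hA2c.measurable.add ?_).sub ?_
    · exact hUmeas.comp (measurable_snd.prodMk measurable_fst)
    · exact hUmeas.comp ((hσm.comp measurable_snd).prodMk measurable_fst)
  have hGb : ∀ s : Shift r M × Shift r M,
      |A s.1 s.2 + U s.1 s.2 - U s.1 (shiftMap s.2)| ≤ FA + 2 * (C + K) := by
    intro s
    have h1 := abs_le.1 (hFA' s.1 s.2)
    have h2 := abs_le.1 (hUabs s.1 s.2)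
    have h3 := abs_le.1 (hUabs s.1 (shiftMap s.2))
    rw [abs_le]
    constructor <;> linarith [h1.1, h1.2, h2.1, h2.2, h3.1, h3.2]
  refine ⟨U, fun y => ⟨⟨_, hUlip y⟩, fun x => ?_, ?_⟩, hGm, ⟨_, hGb⟩, ?_⟩
  · rw [hcy]
    have := hUineq y x
    simp only [hf] at this
    linarith
  · obtain ⟨ν, hν, hνe⟩ := maxErg_attained hne (hBc y)
    refine ⟨ν, hν, hνe, ?_⟩
    rw [hcy] at hνe ⊢
    have := hν.1
    have hUs : Continuous (fun x => U y (shiftMap x)) := (hUc y).comp shiftMap_cont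
    have hgc : Continuous (fun x => -(f y x + U y x - U y (shiftMap x))) :=
      (((hfc y).add (hUc y)).sub hUs).neg
    have hint : ∫ x, -(f y x + U y x - U y (shiftMap x)) ∂ν = 0 := by
      rw [integral_neg, integral_sub (f := fun x => f y x + U y x)
        ((cont_int (hfc y) ν).add (cont_int (hUc y) ν))
        (cont_int hUs ν), integral_add (cont_int (hfc y) ν) (cont_int (hUc y) ν),
        int_comp_shift hν (hUc y)]
      have : ∫ x, f y x ∂ν = 0 := by
        simp only [hf]
        rw [integral_sub (cont_int (hBc y) ν) (integrable_const c), hνe]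
        simp
      rw [this]; ring
    have h0 : 0 ≤ fun x => -(f y x + U y x - U y (shiftMap x)) := fun x => by
      have := hUineq y x
      simp only [Pi.zero_apply]
      linarith
    have hae := (integral_eq_zero_iff_of_nonneg h0 (cont_int hgc ν)).1 hint
    filter_upwards [hae] with x hx
    simp only [Pi.zero_apply, hf] at hx
    linarith
  · have hgreat : IsGreatest {t : ℝ | ∃ η : Measure (Shift r M × Shift r M),
        IsProbabilityMeasure η ∧
        η {p : Shift r M × Shift r M | M (p.1.1 0) (p.2.1 0) = true}ᶜ = 0 ∧
        η.map Prod.fst = η.map Prod.snd ∧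
        t = ∫ p, (A p.1 p.2 + U p.1 p.2 - U p.1 (shiftMap p.2)) ∂η} c := by
      constructor
      · have hT : Measurable (fun x : Shift r M => (x, shiftMap x)) := measurable_id.prodMk hσm
        refine ⟨(orbMeas 2 p).map (fun x => (x, shiftMap x)), ?_, ?_, ?_, ?_⟩
        · have := hμ0.1
          exact Measure.isProbabilityMeasure_map hT.aemeasurable
        · have hms : MeasurableSet
              {p : Shift r M × Shift r M | M (p.1.1 0) (p.2.1 0) = true} := by
            have h1 : Measurable (fun s : Fin r × Fin r => M s.1 s.2) := measurable_of_finite _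
            have h2 : Measurable (fun x : Shift r M => x.1 0) :=
              (measurable_pi_apply 0).comp measurable_subtype_coe
            have h3 : Measurable (fun s : Shift r M × Shift r M => (s.1.1 0, s.2.1 0)) :=
              (h2.comp measurable_fst).prodMk (h2.comp measurable_snd)
            exact (h1.comp h3) (measurableSet_singleton true)
          rw [Measure.map_apply hT hms.compl]
          convert measure_empty (μ := orbMeas 2 p)
          ext x
          simp only [Set.mem_preimage, Set.mem_compl_iff, Set.mem_ofPred_eq,
            Set.mem_empty_iff_false, iff_false, not_not]
          exact x.2 0
        · rw [Measure.map_map measurable_fst hT, Measure.map_map measurable_snd hT]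
          have h1 : (Prod.fst ∘ fun x : Shift r M => (x, shiftMap x)) = id := rfl
          have h2 : (Prod.snd ∘ fun x : Shift r M => (x, shiftMap x)) = shiftMap := rfl
          rw [h1, h2, Measure.map_id, hμ0.2]
        · rw [integral_map hT.aemeasurable hGm.aestronglyMeasurable, orb_integral]
          rw [birkhoffSum_succ, birkhoffSum_one, Function.iterate_one]
          simp only [hpq, hqp]
          have h1 := hUeq p
          have h2 := hUeq q
          rw [hselp, hqp] at h1
          rw [hselq, hpq] at h2
          simp only [hf] at h1 h2
          push_cast
          linarith
      · rintro _ ⟨η, hη, -, hmarg, rfl⟩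
        have hV1 : Continuous (fun s : Shift r M × Shift r M => V s.1) := hVc.comp continuous_fst
        have hV2 : Continuous (fun s : Shift r M × Shift r M => V s.2) := hVc.comp continuous_snd
        have i1 : Integrable (fun s : Shift r M × Shift r M => V s.1) η :=
          Integrable.of_bound hV1.measurable.aestronglyMeasurable FV
            (Filter.Eventually.of_forall fun s => hFV s.1)
        have i2 : Integrable (fun s : Shift r M × Shift r M => V s.2) η :=
          Integrable.of_bound hV2.measurable.aestronglyMeasurable FV
            (Filter.Eventually.of_forall fun s => hFV s.2)
        have i3 := Integrable.of_bound hGm.aestronglyMeasurable (μ := η) (FA + 2 * (C + K))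
          (Filter.Eventually.of_forall hGb)
        have e1 : ∫ s, V s.1 ∂η = ∫ s, V s.2 ∂η := by
          rw [← integral_map (μ := η) (φ := Prod.fst) measurable_fst.aemeasurable
            hVc.measurable.aestronglyMeasurable, hmarg,
            integral_map measurable_snd.aemeasurable hVc.measurable.aestronglyMeasurable]
        have hle : ∫ s, (A s.1 s.2 + U s.1 s.2 - U s.1 (shiftMap s.2)) ∂η
            ≤ ∫ s, ((c + V s.1) - V s.2) ∂η := by
          refine integral_mono i3 (((integrable_const c).add i1).sub i2) fun s => ?_
          have := hUineq s.1 s.2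
          simp only [hf] at this
          show A s.1 s.2 + U s.1 s.2 - U s.1 (shiftMap s.2) ≤ (c + V s.1) - V s.2
          linarith
        rw [integral_sub (f := fun s : Shift r M × Shift r M => c + V s.1)
          ((integrable_const c).add i1) i2, integral_add (integrable_const c) i1, e1] at hle
        simpa using hle
    rw [hgreat.csSup_eq]
    exact hlim
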